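/- Let n be odd, let U : ℝᵈ → M_N(ℂ) be a smooth map taking values in unitary matrices, let x₀ ∈ ℝᵈ and v₁, …, vₙ ∈ ℝᵈ. Define, for (ε₁,…,εₙ) in a sufficiently small neighborhood of 0 in ℝⁿ, f(ε₁,…,εₙ) = Chⁿ( U(x₀), U(x₀+ε₁v₁), …, U(x₀+εₙvₙ) ). Then the mixed partial derivative satisfies ∂ⁿf/∂ε₁⋯∂εₙ |_{ε=0} = cₙ · (1/n!) · Σ_{σ∈Sₙ} sgn(σ) tr( U(x₀)⁻¹(D_{v_{σ(1)}}U)(x₀) ⋯ U(x₀)⁻¹(D_{v_{σ(n)}}U)(x₀) ), where D_v denotes the directional derivative along v. Hence the image of the Alexander–Spanier cochain Chⁿ under the canonical map to de Rham forms is cₙ Tr(U⁻¹dU)ⁿ. -/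

import Mathlib

open scoped Matrix.Norms.L2Operator
open MeasureTheory

/-- The standard `n`-simplex `Δⁿ = {t ∈ ℝⁿ : tᵢ ≥ 0, Σᵢ tᵢ ≤ 1}`. -/
def simplexΔ (n : ℕ) : Set (Fin n → ℝ) := {t | (∀ i, 0 ≤ t i) ∧ ∑ i, t i ≤ 1}

/-- `V(t) = Σⱼ₌₀ⁿ tⱼ Uⱼ`, with `t₀ = 1 − Σᵢ₌₁ⁿ tᵢ`. -/
noncomputable def simplexComb {n N : ℕ} (U : Fin (n + 1) → Matrix (Fin N) (Fin N) ℂ)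
    (t : Fin n → ℝ) : Matrix (Fin N) (Fin N) ℂ :=
  (((1 - ∑ i, t i : ℝ)) : ℂ) • U 0 + ∑ i : Fin n, ((t i : ℝ) : ℂ) • U i.succ

/-- The constant `cₙ = (−1)^((n−1)/2) ((n−1)/2)! / ((2πi)^((n+1)/2) n!)`. -/
noncomputable def oddChernConst (n : ℕ) : ℂ :=
  ((-1) ^ ((n - 1) / 2) * (Nat.factorial ((n - 1) / 2) : ℂ)) /
    ((2 * Real.pi * Complex.I) ^ ((n + 1) / 2) * (Nat.factorial n : ℂ))

/-- The odd Chern character cochain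
`Chⁿ(U₀,…,Uₙ) = cₙ ∫_{Δⁿ} Σ_{σ∈Sₙ} sgn σ · tr(V(t)⁻¹δ_{σ(1)} ⋯ V(t)⁻¹δ_{σ(n)}) dt`,
where `δⱼ = Uⱼ − U₀`. -/
noncomputable def chOdd (n N : ℕ) (U : Fin (n + 1) → Matrix (Fin N) (Fin N) ℂ) : ℂ :=
  oddChernConst n *
    ∫ t in simplexΔ n, ∑ σ : Equiv.Perm (Fin n),
      ((Equiv.Perm.sign σ : ℤ) : ℂ) *
        Matrix.trace
          (((List.finRange n).map fun i =>
              (simplexComb U t)⁻¹ * (U (σ i).succ - U 0)).prod)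


theorem auxList_contDiffAt {N : ℕ} {E ι : Type} [NormedAddCommGroup E] [NormedSpace ℝ E]
    (G : ι → E → Matrix (Fin N) (Fin N) ℂ) (p : E)
    (hG : ∀ i, ContDiffAt ℝ (⊤ : ℕ∞) (G i) p) (l : List ι) :
    ContDiffAt ℝ (⊤ : ℕ∞) (fun q => (l.map fun i => G i q).prod) p := by
  induction l with
  | nil => simpa using contDiffAt_const
  | cons a l ih =>
    simp only [List.map_cons, List.prod_cons]
    exact (hG a).mul ih

theorem auxList_continuousAt {N : ℕ} {E ι : Type} [TopologicalSpace E]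
    (G : ι → E → Matrix (Fin N) (Fin N) ℂ) (p : E)
    (hG : ∀ i, ContinuousAt (G i) p) (l : List ι) :
    ContinuousAt (fun q => (l.map fun i => G i q).prod) p := by
  induction l with
  | nil => simpa using continuousAt_const
  | cons a l ih =>
    simp only [List.map_cons, List.prod_cons]
    exact (hG a).mul ih

theorem auxInv_contDiffAt {N : ℕ} (A : Matrix (Fin N) (Fin N) ℂ) (hA : IsUnit A) :
    ContDiffAt ℝ (⊤ : ℕ∞) (fun B : Matrix (Fin N) (Fin N) ℂ => B⁻¹) A := by
  obtain ⟨u, rfl⟩ := hA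
  have h := contDiffAt_ringInverse ℝ (n := (⊤ : ℕ∞)) u
  have e : (fun B : Matrix (Fin N) (Fin N) ℂ => B⁻¹) = Ring.inverse := by
    ext1 B; exact Matrix.nonsing_inv_eq_ringInverse B
  rw [e]; exact h

/-- trace as a continuous real-linear map -/
noncomputable def auxTrace (N : ℕ) : Matrix (Fin N) (Fin N) ℂ →L[ℝ] ℂ :=
  LinearMap.toContinuousLinearMap (Matrix.traceLinearMap (Fin N) ℝ ℂ)

theorem auxTrace_apply (N : ℕ) (A : Matrix (Fin N) (Fin N) ℂ) : auxTrace N A = A.trace := rfl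

theorem auxList_smul {N : ℕ} {ι : Type} (l : List ι) (x : ι → ℝ)
    (A : Matrix (Fin N) (Fin N) ℂ) (B : ι → Matrix (Fin N) (Fin N) ℂ) :
    (l.map fun i => A * (x i • B i)).prod = (l.map x).prod • (l.map fun i => A * B i).prod := by
  induction l with
  | nil => simp
  | cons a l ih =>
    simp only [List.map_cons, List.prod_cons, ih]
    rw [mul_smul_comm (x a) A, smul_mul_smul_comm]

section AuxLemmas
open Filter Topology

/-- local boundedness, uniformly over a compact parameter set -/
theorem aux_bound {E T G : Type} [NormedAddCommGroup E] [TopologicalSpace T]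
    [NormedAddCommGroup G] {K : Set T} (hK : IsCompact K) (F : E × T → G) (x : E)
    (hF : ∀ t ∈ K, ContinuousAt F (x, t)) :
    ∃ C : ℝ, ∀ᶠ y in 𝓝 x, ∀ t ∈ K, ‖F (y, t)‖ ≤ C := by
  have hc : ContinuousOn (fun t => F (x, t)) K := fun t ht =>
    ((hF t ht).comp (f := fun t => (x, t)) (by fun_prop)).continuousWithinAt
  obtain ⟨C, hC⟩ := hK.exists_bound_of_continuousOn hc
  refine ⟨C + 1, hK.eventually_forall_of_forall_eventually (P := fun y t => ‖F (y, t)‖ ≤ C + 1) ?_⟩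
  intro t ht
  have h1 := (hF t ht).norm.eventually_lt_const (u := C + 1) (by linarith [hC t ht])
  filter_upwards [h1] with z hz using hz.le

theorem aux_aesm {E T G : Type} [NormedAddCommGroup E] [TopologicalSpace T]
    [MeasurableSpace T] [BorelSpace T] [SecondCountableTopology T] [T2Space T] (μ : Measure T)
    [NormedAddCommGroup G] {K : Set T} (hK : IsCompact K) (F : E × T → G) (x : E)
    (hF : ∀ t ∈ K, ContinuousAt F (x, t)) :
    AEStronglyMeasurable (fun t => F (x, t)) (μ.restrict K) := by
  have hc : ContinuousOn (fun t => F (x, t)) K := fun t ht =>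
    ((hF t ht).comp (f := fun t => (x, t)) (by fun_prop)).continuousWithinAt
  exact hc.aestronglyMeasurable_of_isCompact hK hK.measurableSet

theorem aux_cont {E T G : Type} [NormedAddCommGroup E] [TopologicalSpace T]
    [MeasurableSpace T] [BorelSpace T] [SecondCountableTopology T] [T2Space T] (μ : Measure T)
    [IsFiniteMeasureOnCompacts μ]
    [NormedAddCommGroup G] [NormedSpace ℝ G] {K : Set T} (hK : IsCompact K) (F : E × T → G)
    {s : Set E} (hs : IsOpen s)
    (hF : ∀ x ∈ s, ∀ t ∈ K, ContinuousAt F (x, t)) :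
    ContinuousOn (fun x => ∫ t in K, F (x, t) ∂μ) s := by
  intro x hx
  apply ContinuousAt.continuousWithinAt
  obtain ⟨C, hC⟩ := aux_bound hK F x (hF x hx)
  have : IsFiniteMeasure (μ.restrict K) := ⟨by simpa using hK.measure_lt_top⟩
  refine continuousAt_of_dominated (bound := fun _ => C) ?_ ?_ (integrable_const _) ?_
  · filter_upwards [hs.mem_nhds hx] with y hy using aux_aesm μ hK F y (hF y hy)
  · filter_upwards [hC] with y hy
    exact (ae_restrict_iff' hK.measurableSet).2 (Eventually.of_forall hy)
  · refine (ae_restrict_iff' hK.measurableSet).2 (Eventually.of_forall fun t ht => ?_)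
    exact (hF x hx t ht).comp (f := fun y => (y, t)) (by fun_prop)

theorem aux_fderiv {E T G : Type} [NormedAddCommGroup E] [NormedSpace ℝ E]
    [NormedAddCommGroup T] [NormedSpace ℝ T]
    [MeasurableSpace T] [BorelSpace T] [SecondCountableTopology T] (μ : Measure T)
    [IsFiniteMeasureOnCompacts μ]
    [NormedAddCommGroup G] [NormedSpace ℝ G] {K : Set T} (hK : IsCompact K) (F : E × T → G)
    {s : Set E} (hs : IsOpen s)
    (hF : ∀ x ∈ s, ∀ t ∈ K, ContDiffAt ℝ (⊤ : ℕ∞) F (x, t)) (x : E) (hx : x ∈ s) :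
    HasFDerivAt (fun x => ∫ t in K, F (x, t) ∂μ)
      (∫ t in K, (fderiv ℝ F (x, t)).comp (ContinuousLinearMap.inl ℝ E T) ∂μ) x := by
  have hF' : ∀ x ∈ s, ∀ t ∈ K, ContinuousAt
      (fun p : E × T => (fderiv ℝ F p).comp (ContinuousLinearMap.inl ℝ E T)) (x, t) := by
    intro x hx t ht
    have h1 := ((hF x hx t ht).fderiv_right (m := 0) (by simp)).continuousAt
    exact h1.clm_comp continuousAt_const
  have hFc : ∀ x ∈ s, ∀ t ∈ K, ContinuousAt F (x, t) := fun x hx t ht =>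
    (hF x hx t ht).continuousAt
  obtain ⟨C, hC⟩ := aux_bound hK _ x (hF' x hx)
  obtain ⟨C0, hC0⟩ := aux_bound hK _ x (hFc x hx)
  have : IsFiniteMeasure (μ.restrict K) := ⟨by simpa using hK.measure_lt_top⟩
  have hC' := hC.and (hs.mem_nhds hx)
  refine hasFDerivAt_integral_of_dominated_of_fderiv_le (bound := fun _ => C) (𝕜 := ℝ)
    (F := fun x t => F (x, t))
    (F' := fun x t => (fderiv ℝ F (x, t)).comp (ContinuousLinearMap.inl ℝ E T)) hC'
    ?_ ?_ ?_ ?_ (integrable_const _) ?_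
  · filter_upwards [hs.mem_nhds hx] with y hy using aux_aesm μ hK F y (hFc y hy)
  · refine Integrable.mono' (integrable_const C0) (aux_aesm μ hK F x (hFc x hx)) ?_
    exact (ae_restrict_iff' hK.measurableSet).2 (Eventually.of_forall hC0.self_of_nhds)
  · exact aux_aesm μ hK _ x (hF' x hx)
  · refine (ae_restrict_iff' hK.measurableSet).2 (Eventually.of_forall fun t ht => ?_)
    intro y hy
    exact hy.1 t ht
  · refine (ae_restrict_iff' hK.measurableSet).2 (Eventually.of_forall fun t ht => ?_)
    intro y hy
    have h1 := ((hF y hy.2 t ht).differentiableAt (by simp)).hasFDerivAt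
    have h2 : HasFDerivAt (fun y : E => (y, t)) (ContinuousLinearMap.inl ℝ E T) y :=
      hasFDerivAt_prodMk_left y t
    exact h1.comp y h2

theorem aux_contDiff {E T : Type} [NormedAddCommGroup E] [NormedSpace ℝ E]
    [NormedAddCommGroup T] [NormedSpace ℝ T]
    [MeasurableSpace T] [BorelSpace T] [SecondCountableTopology T] (μ : Measure T)
    [IsFiniteMeasureOnCompacts μ] {K : Set T} (hK : IsCompact K)
    {s : Set E} (hs : IsOpen s) (m : ℕ) :
    ∀ (G : Type) [NormedAddCommGroup G] [NormedSpace ℝ G] (F : E × T → G)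
    (_ : ∀ x ∈ s, ∀ t ∈ K, ContDiffAt ℝ (⊤ : ℕ∞) F (x, t)),
    ContDiffOn ℝ m (fun x => ∫ t in K, F (x, t) ∂μ) s := by
  induction m with
  | zero =>
    intro G _ _ F hF
    simp only [Nat.cast_zero, contDiffOn_zero]
    exact aux_cont μ hK F hs fun x hx t ht => (hF x hx t ht).continuousAt
  | succ m ih =>
    intro G _ _ F hF
    push_cast
    rw [contDiffOn_succ_iff_fderiv_of_isOpen hs]
    refine ⟨fun x hx => (aux_fderiv μ hK F hs hF x hx).differentiableAt.differentiableWithinAt,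
      by simp, ?_⟩
    refine (ih _ (fun p => (fderiv ℝ F p).comp (ContinuousLinearMap.inl ℝ E T)) ?_).congr
      fun x hx => (aux_fderiv μ hK F hs hF x hx).fderiv
    intro x hx t ht
    exact ((hF x hx t ht).fderiv_right (m := (⊤ : ℕ∞)) (by simp)).clm_comp contDiffAt_const

/-- embedding appending a zero -/
noncomputable def auxEmb (n : ℕ) : (Fin n → ℝ) →L[ℝ] (Fin (n + 1) → ℝ) :=
  ContinuousLinearMap.pi (Fin.snoc (α := fun _ => (Fin n → ℝ) →L[ℝ] ℝ)
    (fun i => ContinuousLinearMap.proj i) 0)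

theorem auxEmb_castSucc (n : ℕ) (x : Fin n → ℝ) (i : Fin n) : auxEmb n x i.castSucc = x i := by
  simp [auxEmb]

theorem auxEmb_last (n : ℕ) (x : Fin n → ℝ) : auxEmb n x (Fin.last n) = 0 := by
  simp [auxEmb]

theorem auxEmb_single (n : ℕ) (i : Fin n) :
    auxEmb n (Pi.single i 1) = Pi.single i.castSucc 1 := by
  ext j
  refine Fin.lastCases ?_ (fun j => ?_) j
  · rw [auxEmb_last, Pi.single_eq_of_ne]
    exact (Fin.castSucc_lt_last i).ne'
  · rw [auxEmb_castSucc]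
    simp [Pi.single_apply]

theorem aux_mixed (n : ℕ) : ∀ (f h : (Fin n → ℝ) → ℂ) (s : Set (Fin n → ℝ)) (_ : IsOpen s)
    (_ : (0 : Fin n → ℝ) ∈ s) (_ : ContDiffOn ℝ (n : ℕ∞) f s) (_ : ContinuousOn h s)
    (_ : ∀ x ∈ s, f x = (∏ i, x i) • h x),
    iteratedFDeriv ℝ n f 0 (fun i => Pi.single i 1) = h 0 := by
  induction n with
  | zero =>
    intro f h s hs h0 hf hh hfh
    rw [iteratedFDeriv_zero_apply, hfh 0 h0]
    simp
  | succ n ih =>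
    intro f h s hs h0 hf hh hfh
    have hf1 : ContDiffOn ℝ (n : ℕ∞) (fderiv ℝ f) s := hf.fderiv_of_isOpen hs (by simp)
    rw [iteratedFDeriv_succ_apply_right]
    set L : ((Fin (n+1) → ℝ) →L[ℝ] ℂ) →L[ℝ] ℂ :=
      ContinuousLinearMap.apply ℝ ℂ (Pi.single (Fin.last n) 1 : Fin (n+1) → ℝ)
    have e1 : ContDiffOn ℝ (n : ℕ∞) (L ∘ fderiv ℝ f) s := hf1.continuousLinearMap_comp L
    have hemb0 : auxEmb n 0 ∈ s := by simpa using h0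
    have ho : IsOpen (auxEmb n ⁻¹' s) := hs.preimage (auxEmb n).continuous
    have key := ih ((L ∘ fderiv ℝ f) ∘ auxEmb n) (h ∘ auxEmb n) (auxEmb n ⁻¹' s) ho hemb0
      (e1.comp (auxEmb n).contDiff.contDiffOn (fun _ hx => hx))
      (hh.comp (auxEmb n).continuous.continuousOn (fun _ hx => hx)) ?_
    · rw [← iteratedFDerivWithin_of_isOpen n ho hemb0,
        (auxEmb n).iteratedFDerivWithin_comp_right e1 hs.uniqueDiffOn ho.uniqueDiffOn hemb0
          (by simp), iteratedFDerivWithin_of_isOpen n hs hemb0,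
        L.iteratedFDeriv_comp_left ((hf1.contDiffAt (hs.mem_nhds hemb0))) (by simp)] at key
      simp only [Function.comp_apply, map_zero,
        ContinuousMultilinearMap.compContinuousLinearMap_apply, auxEmb_single] at key
      exact key
    · intro x hx
      simp only [Function.comp_apply]
      have hd : HasFDerivAt f (fderiv ℝ f (auxEmb n x)) (auxEmb n x) :=
        ((hf.contDiffAt (hs.mem_nhds hx)).differentiableAt (by simp)).hasFDerivAt
      set γ : ℝ → (Fin (n+1) → ℝ) := fun r => auxEmb n x + r • Pi.single (Fin.last n) 1
      have hγ0 : γ 0 = auxEmb n x := by simp [γ]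
      have hγ : HasDerivAt γ (Pi.single (Fin.last n) 1) 0 := by
        have := ((hasDerivAt_id (0:ℝ)).smul_const
          (Pi.single (Fin.last n) 1 : Fin (n+1) → ℝ)).const_add (auxEmb n x)
        simp only [one_smul] at this
        exact this
      have h1 : HasDerivAt (f ∘ γ) (L (fderiv ℝ f (auxEmb n x))) 0 := by
        rw [← hγ0] at hd ⊢
        exact hd.comp_hasDerivAt 0 hγ
      have hγc : ContinuousAt γ 0 := hγ.continuousAt
      have hmem : ∀ᶠ r in 𝓝 (0:ℝ), γ r ∈ s :=
        hγc.eventually_mem (by rw [hγ0]; exact hs.mem_nhds hx)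
      have hprod : ∀ r, ∏ i, γ r i = (∏ i, x i) * r := by
        intro r
        rw [Fin.prod_univ_castSucc]
        simp [γ, auxEmb_castSucc, auxEmb_last, (Fin.castSucc_lt_last _).ne]
      have h2 : HasDerivAt (f ∘ γ) ((∏ i, x i) • h (auxEmb n x)) 0 := by
        rw [hasDerivAt_iff_tendsto_slope]
        have hc : ContinuousAt (fun r => (∏ i, x i) • h (γ r)) 0 := by
          refine ContinuousAt.fun_const_smul ?_ _
          refine ContinuousAt.comp (g := h) ?_ hγc
          rw [hγ0]; exact hh.continuousAt (hs.mem_nhds hx)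
        have hc' := hc.tendsto.mono_left (nhdsWithin_le_nhds (s := {0}ᶜ))
        simp only [hγ0] at hc'
        refine hc'.congr' ?_
        filter_upwards [hmem.filter_mono nhdsWithin_le_nhds, self_mem_nhdsWithin] with r hr hr0
        have hr0' : r ≠ 0 := hr0
        have hz : f (γ 0) = 0 := by
          rw [hfh _ (by rw [hγ0]; exact hx), hprod]; simp
        simp only [slope, Function.comp_apply, vsub_eq_sub, hz, hfh _ hr, hprod, sub_zero,
          smul_smul]
        congr 1
        field_simp
      exact h1.unique h2

theorem auxSimplex_closed (n : ℕ) (r : ℝ) :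
    IsClosed {t : Fin n → ℝ | (∀ i, 0 ≤ t i) ∧ ∑ i, t i ≤ r} := by
  have : {t : Fin n → ℝ | (∀ i, 0 ≤ t i) ∧ ∑ i, t i ≤ r} =
      (⋂ i, {t | 0 ≤ t i}) ∩ {t | ∑ i, t i ≤ r} := by ext; simp
  rw [this]
  refine IsClosed.inter (isClosed_iInter fun i => isClosed_le (by fun_prop) (by fun_prop))
    (isClosed_le (by fun_prop) (by fun_prop))

theorem auxSimplex_compact (n : ℕ) : IsCompact (simplexΔ n) := by
  refine (isCompact_Icc (a := (0 : Fin n → ℝ)) (b := 1)).of_isClosed_subset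
    (auxSimplex_closed n 1) ?_
  rintro t ⟨h1, h2⟩
  refine ⟨h1, fun i => le_trans (Finset.single_le_sum (fun j _ => h1 j) (Finset.mem_univ i)) h2⟩

theorem auxSimplex_volume (n : ℕ) : ∀ r : ℝ, 0 ≤ r →
    volume {t : Fin n → ℝ | (∀ i, 0 ≤ t i) ∧ ∑ i, t i ≤ r} =
      ENNReal.ofReal (r ^ n / n.factorial) := by
  induction n with
  | zero =>
    intro r hr
    have : {t : Fin 0 → ℝ | (∀ i, 0 ≤ t i) ∧ ∑ i, t i ≤ r} = Set.univ := by
      ext; simp [hr]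
    rw [this, volume_pi, Measure.pi_univ]; simp
  | succ n ih =>
    intro r hr
    have hmp := (volume_preserving_piFinSuccAbove (fun _ : Fin (n+1) => ℝ) 0).symm
    have hm := (auxSimplex_closed (n+1) r).measurableSet
    rw [← hmp.measure_preimage hm.nullMeasurableSet, Measure.volume_eq_prod,
      Measure.prod_apply ((MeasurableEquiv.measurable _) hm)]
    have hsl : ∀ x : ℝ, volume (Prod.mk x ⁻¹' ((MeasurableEquiv.piFinSuccAbove (fun _ : Fin (n+1) => ℝ) 0).symm ⁻¹'
        {t : Fin (n+1) → ℝ | (∀ i, 0 ≤ t i) ∧ ∑ i, t i ≤ r})) =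
        (Set.Icc 0 r).indicator (fun x => ENNReal.ofReal ((r - x) ^ n / n.factorial)) x := by
      intro x
      by_cases hx : x ∈ Set.Icc 0 r
      · rw [Set.indicator_of_mem hx, ← ih (r - x) (by linarith [hx.2])]
        congr 1
        ext t
        have h1 := hx.1
        simp [MeasurableEquiv.piFinSuccAbove_symm_apply, Fin.forall_fin_succ, Fin.sum_univ_succ,
          h1, le_sub_iff_add_le, add_comm]
      · rw [Set.indicator_of_notMem hx]
        convert measure_empty (μ := (volume : Measure (Fin n → ℝ)))
        ext t
        simp only [MeasurableEquiv.piFinSuccAbove_symm_apply, Fin.forall_fin_succ,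
          Fin.sum_univ_succ, Set.mem_preimage, Set.mem_ofPred_eq, Set.mem_empty_iff_false, iff_false]
        simp only [Fin.insertNthEquiv, Equiv.coe_fn_mk, Fin.insertNth_zero, Fin.cons_zero, Fin.cons_succ]
        rintro ⟨⟨h1, h2⟩, h3⟩
        have := Finset.sum_nonneg (s := Finset.univ) (fun i _ => h2 i)
        exact hx ⟨h1, by linarith⟩
    rw [lintegral_congr hsl, lintegral_indicator measurableSet_Icc,
      ← ofReal_integral_eq_lintegral_ofReal]
    · congr 1
      rw [integral_Icc_eq_integral_Ioc, ← intervalIntegral.integral_of_le hr,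
        intervalIntegral.integral_div,
        intervalIntegral.integral_comp_sub_left (fun x => x ^ n) r]
      simp [Nat.factorial_succ]
      field_simp
    · exact (ContinuousOn.integrableOn_compact isCompact_Icc (by fun_prop))
    · refine (ae_restrict_iff' measurableSet_Icc).2 (Eventually.of_forall fun x hx => ?_)
      have : 0 ≤ r - x := by linarith [hx.2]
      simp only [Pi.zero_apply]
      positivity

end AuxLemmas

/-- for a smooth unitary-valued map `U` on `ℝᵈ`, the mixed partial derivative
at `ε = 0` of `f(ε₁,…,εₙ) = Chⁿ(U(x₀), U(x₀+ε₁v₁), …, U(x₀+εₙvₙ))` equals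
`cₙ (1/n!) Σ_σ sgn σ · tr(U(x₀)⁻¹ D_{v_{σ(1)}}U(x₀) ⋯ U(x₀)⁻¹ D_{v_{σ(n)}}U(x₀))`,
i.e. the image of `Chⁿ` in de Rham cohomology is `cₙ Tr(U⁻¹dU)ⁿ`. -/
theorem chOdd_mixed_partial_at_zero
    (N n d : ℕ) (hn : Odd n)
    (U : (Fin d → ℝ) → Matrix (Fin N) (Fin N) ℂ)
    (hsm : ContDiff ℝ (⊤ : ℕ∞) U)
    (hU : ∀ x, U x ∈ Matrix.unitaryGroup (Fin N) ℂ)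
    (x₀ : Fin d → ℝ) (v : Fin n → Fin d → ℝ) :
    iteratedFDeriv ℝ n
        (fun ε : Fin n → ℝ =>
          chOdd n N (fun j => Fin.cases (U x₀) (fun i => U (x₀ + ε i • v i)) j))
        0 (fun i => Pi.single i 1) =
      oddChernConst n * (1 / (Nat.factorial n : ℂ)) *
        ∑ σ : Equiv.Perm (Fin n),
          ((Equiv.Perm.sign σ : ℤ) : ℂ) *
            Matrix.trace
              (((List.finRange n).map fun i =>
                (U x₀)⁻¹ * fderiv ℝ U x₀ (v (σ i))).prod) := by
  classical
  set K := simplexΔ n with hKdef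
  have hK : IsCompact K := auxSimplex_compact n
  -- the convex combination as a function of `(ε, t)`
  set W : (Fin n → ℝ) × (Fin n → ℝ) → Matrix (Fin N) (Fin N) ℂ := fun p =>
    (((1 - ∑ i, p.2 i : ℝ)) : ℂ) • U x₀ + ∑ i : Fin n, ((p.2 i : ℝ) : ℂ) • U (x₀ + p.1 i • v i)
    with hW
  have hWs : ContDiff ℝ (⊤ : ℕ∞) W := by
    have h1 : ∀ i, ContDiff ℝ (⊤ : ℕ∞)
        (fun p : (Fin n → ℝ) × (Fin n → ℝ) => U (x₀ + p.1 i • v i)) := fun i =>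
      hsm.comp (by fun_prop)
    have h2 : ∀ p, W p = (1 - ∑ i, p.2 i : ℝ) • U x₀ + ∑ i : Fin n, (p.2 i) • U (x₀ + p.1 i • v i) :=
      fun p => rfl
    rw [funext h2]
    fun_prop
  have hW0 : ∀ t, W (0, t) = U x₀ := by
    intro t
    simp only [hW, Pi.zero_apply, zero_smul, add_zero]
    rw [← Finset.sum_smul, ← add_smul]
    simp
  have hUu : IsUnit (U x₀) := IsUnit.of_mul_eq_one _ (Matrix.mem_unitaryGroup_iff.1 (hU x₀))
  have hnear : ∀ᶠ ε in nhds (0 : Fin n → ℝ), ∀ t ∈ K, IsUnit (W (ε, t)) := by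
    refine hK.eventually_forall_of_forall_eventually (P := fun ε t => IsUnit (W (ε, t))) ?_
    intro t _
    refine hWs.continuous.continuousAt.eventually_mem (s := {A | IsUnit A}) ?_
    rw [hW0]
    exact Units.isOpen.mem_nhds hUu
  obtain ⟨s, hsu, hs, h0⟩ := eventually_nhds_iff.1 hnear
  have hinv : ∀ x ∈ s, ∀ t ∈ K, ContDiffAt ℝ (⊤ : ℕ∞) (fun p => (W p)⁻¹) (x, t) :=
    fun x hx t ht => (auxInv_contDiffAt _ (hsu x hx t ht)).comp (x, t) hWs.contDiffAt
  -- the difference quotients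
  set φ : Fin n → ℝ → Matrix (Fin N) (Fin N) ℂ := fun i r => U (x₀ + r • v i) with hφ
  have hφs : ∀ i, ContDiff ℝ (⊤ : ℕ∞) (φ i) := fun i => hsm.comp (by fun_prop)
  set g : Fin n → ℝ → Matrix (Fin N) (Fin N) ℂ := fun i => dslope (φ i) 0 with hg
  have hgc : ∀ i, Continuous (g i) := by
    intro i
    rw [← continuousOn_univ]
    exact (continuousOn_dslope Filter.univ_mem).2 ⟨(hφs i).continuous.continuousOn,
      ((hφs i).differentiable (by simp)).differentiableAt⟩
  have hg0 : ∀ i, g i 0 = fderiv ℝ U x₀ (v i) := by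
    intro i
    simp only [hg, dslope_same]
    have h1 : HasFDerivAt U (fderiv ℝ U (x₀ + (0:ℝ) • v i)) (x₀ + (0:ℝ) • v i) :=
      ((hsm.differentiable (by simp)) _).hasFDerivAt
    have h2 : HasDerivAt (fun r : ℝ => x₀ + r • v i) (v i) 0 := by
      have := ((hasDerivAt_id (0:ℝ)).smul_const (v i)).const_add x₀
      simp only [one_smul] at this
      exact this
    have h3 := (h1.comp_hasDerivAt (0:ℝ) h2).deriv
    rw [zero_smul, add_zero] at h3
    exact h3
  have hsub : ∀ i r, U (x₀ + r • v i) - U x₀ = r • g i r := by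
    intro i r
    have := sub_smul_dslope (φ i) 0 r
    simp only [sub_zero, hφ, zero_smul, add_zero] at this
    exact this.symm
  -- the integrands
  set P : (Fin n → Matrix (Fin N) (Fin N) ℂ) → Matrix (Fin N) (Fin N) ℂ → ℂ := fun a B =>
    ∑ σ : Equiv.Perm (Fin n), ((Equiv.Perm.sign σ : ℤ) : ℂ) *
      auxTrace N (((List.finRange n).map fun i => B * a (σ i)).prod) with hP
  set F : (Fin n → ℝ) × (Fin n → ℝ) → ℂ := fun p =>
    P (fun i => U (x₀ + p.1 i • v i) - U x₀) (W p)⁻¹ with hF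
  set H : (Fin n → ℝ) × (Fin n → ℝ) → ℂ := fun p => P (fun i => g i (p.1 i)) (W p)⁻¹ with hH
  have hFs : ∀ x ∈ s, ∀ t ∈ K, ContDiffAt ℝ (⊤ : ℕ∞) F (x, t) := by
    intro x hx t ht
    simp only [hF, hP]
    refine ContDiffAt.sum fun σ _ => contDiffAt_const.mul ?_
    refine (auxTrace N).contDiff.contDiffAt.comp (x, t)
      (auxList_contDiffAt (fun i p => (W p)⁻¹ * (U (x₀ + p.1 (σ i) • v (σ i)) - U x₀)) (x, t) ?_ _)
    intro i
    refine (hinv x hx t ht).mul (ContDiffAt.sub ?_ contDiffAt_const)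
    exact (hsm.comp (by fun_prop)).contDiffAt
  have hHc : ∀ x ∈ s, ∀ t ∈ K, ContinuousAt H (x, t) := by
    intro x hx t ht
    simp only [hH, hP]
    refine tendsto_finsetSum _ fun σ _ => continuousAt_const.mul ?_
    refine (auxTrace N).continuous.continuousAt.comp
      (auxList_continuousAt (fun i p => (W p)⁻¹ * (g (σ i) (p.1 (σ i)))) (x, t) ?_ _)
    intro i
    refine (hinv x hx t ht).continuousAt.mul ?_
    exact ((hgc _).comp (by fun_prop)).continuousAt
  have hFH : ∀ p, F p = (∏ i, p.1 i) • H p := by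
    intro p
    simp only [hF, hH, hP, hsub, Finset.smul_sum]
    refine Finset.sum_congr rfl fun σ _ => ?_
    rw [auxList_smul _ (fun i => p.1 (σ i)), map_smul, mul_smul_comm]
    congr 1
    rw [← List.ofFn_eq_map, List.prod_ofFn]
    exact Equiv.prod_comp σ p.1
  have hfun : (fun ε : Fin n → ℝ =>
      chOdd n N (fun j => Fin.cases (U x₀) (fun i => U (x₀ + ε i • v i)) j)) =
      fun ε => oddChernConst n * ∫ t in K, F (ε, t) := by
    ext ε
    rfl
  rw [hfun, aux_mixed n _ (fun ε => oddChernConst n * ∫ t in K, H (ε, t)) s hs h0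
    (contDiffOn_const.mul (aux_contDiff volume hK hs n ℂ F hFs))
    (continuousOn_const.mul (aux_cont volume hK H hs hHc))]
  · have hconst : ∀ t, H (0, t) = ∑ σ : Equiv.Perm (Fin n),
          ((Equiv.Perm.sign σ : ℤ) : ℂ) *
            Matrix.trace
              (((List.finRange n).map fun i =>
                (U x₀)⁻¹ * fderiv ℝ U x₀ (v (σ i))).prod) := by
      intro t
      simp only [hH, hP, hW0, Pi.zero_apply, hg0, auxTrace_apply]
    have hvol : (volume : Measure (Fin n → ℝ)).real K = 1 / n.factorial := by
      rw [Measure.real, hKdef, simplexΔ, auxSimplex_volume n 1 zero_le_one, one_pow,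
        ENNReal.toReal_ofReal (by positivity)]
    simp only [hconst]
    rw [setIntegral_const, hvol, Complex.real_smul]
    push_cast
    ring
  · intro x _
    simp only [hFH]
    rw [integral_smul, mul_smul_comm]
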